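/- arXiv:2411.15379 — 3 statements merged into one kernel-verified Lean document; each statement's English description precedes it below -/
import Mathlib

section
/- The pushforward under Φ of the product measure dx ⊗ dν(y) on (ℝ/ℤ) × (0,∞), where dx is the Haar probability measure on ℝ/ℤ and dν(y) = 4π e^{−4πy} dy on (0,∞), equals the normalized Lebesgue (area) measure (1/π)·dA on the open unit disc 𝔻 (the point 0 being a null set). -/
open Complex Real MeasureTheory

/-- The map `Φ(x, y) = e^{2πix} e^{−2πy}` from `(ℝ/ℤ) × ℝ` to `ℂ` (only the part `y > 0`
carries the measure below). -/
noncomputable def PhiM (p : AddCircle (1 : ℝ) × ℝ) : ℂ :=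
  (AddCircle.toCircle p.1 : ℂ) * Complex.exp (-(2 * π * p.2))

/-- Angular change of variables `θ = 2πx` on the circle `ℝ/ℤ`. -/
theorem lintegral_polar_angle_eq_lintegral_toCircle (f : ℂ → ENNReal) :
    ∫⁻ θ in Set.Ioo (-π) π, f (Real.cos θ + Real.sin θ * Complex.I) =
      ENNReal.ofReal (2 * π) * ∫⁻ x : AddCircle (1 : ℝ), f (AddCircle.toCircle x) := by
  have himage : (fun x : ℝ => 2 * π * x) '' Set.Ioc (-(1 / 2)) (-(1 / 2) + 1) =
      Set.Ioc (-π) π := by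
    rw [Set.image_mul_left_Ioc (by positivity)]
    congr 1 <;> ring
  rw [← UnitAddCircle.lintegral_preimage (-(1 / 2)), setLIntegral_congr Ioo_ae_eq_Ioc, ← himage,
    lintegral_image_eq_lintegral_abs_deriv_mul (f' := fun _ => 2 * π) measurableSet_Ioc
      (fun x _ => by simpa using ((hasDerivAt_id x).const_mul (2 * π)).hasDerivWithinAt)
      (fun x _ y _ h => mul_left_cancel₀ (by positivity) h),
    abs_of_pos (by positivity), lintegral_const_mul' _ _ ENNReal.ofReal_ne_top]
  simp [AddCircle.toCircle_apply_mk, Circle.coe_exp, Complex.exp_mul_I]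

/-- Radial change of variables `r = e^{−2πy}` from `(0,∞)` to `(0,1)`. -/
theorem setLIntegral_Ioo_zero_one_eq_lintegral_exp_neg (f : ℝ → ENNReal) :
    ∫⁻ r in Set.Ioo (0 : ℝ) 1, f r =
      ∫⁻ y in Set.Ioi (0 : ℝ), ENNReal.ofReal (2 * π * Real.exp (-(2 * π * y))) *
        f (Real.exp (-(2 * π * y))) := by
  have himage : (fun y : ℝ => Real.exp (-(2 * π * y))) '' Set.Ioi 0 = Set.Ioo 0 1 := by
    ext r
    constructor
    · rintro ⟨y, hy, rfl⟩
      have hy : 0 < y := hy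
      exact ⟨Real.exp_pos _, Real.exp_zero ▸ Real.exp_lt_exp.2 (neg_neg_of_pos (by positivity))⟩
    · rintro ⟨h0, h1⟩
      refine ⟨-Real.log r / (2 * π), ?_, ?_⟩
      · exact div_pos (neg_pos.2 (Real.log_neg h0 h1)) (by positivity)
      · beta_reduce
        rw [mul_div_cancel₀ _ (by positivity), neg_neg, Real.exp_log h0]
  rw [← himage, lintegral_image_eq_lintegral_abs_deriv_mul
      (f' := fun y => -(2 * π * Real.exp (-(2 * π * y)))) measurableSet_Ioi]
  · simp_rw [abs_neg]
    congr with y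
    rw [abs_of_pos (by positivity)]
  · intro y _
    have h := ((hasDerivAt_id y).const_mul (2 * π)).neg.exp.hasDerivWithinAt (s := Set.Ioi 0)
    refine h.congr_deriv ?_
    simp; ring
  · intro x _ y _ h
    have h := neg_injective (Real.exp_injective h)
    exact mul_left_cancel₀ (by positivity) h

theorem measurable_PhiM : Measurable PhiM := by
  unfold PhiM
  have h : Continuous fun p : AddCircle (1 : ℝ) × ℝ => (AddCircle.toCircle p.1 : ℂ) :=
    continuous_subtype_val.comp (AddCircle.continuous_toCircle.comp continuous_fst)
  exact (h.mul (by fun_prop)).measurable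

/-- Integration over the unit disc in polar coordinates. -/
theorem setLIntegral_ball_zero_one_polar {f : ℂ → ENNReal} (hf : Measurable f) :
    ∫⁻ z in Metric.ball (0 : ℂ) 1, f z =
      ∫⁻ r in Set.Ioo (0 : ℝ) 1, ENNReal.ofReal r *
        ∫⁻ θ in Set.Ioo (-π) π, f (r * (Real.cos θ + Real.sin θ * Complex.I)) := by
  have hm : Measurable fun p : ℝ × ℝ => ENNReal.ofReal p.1 *
      (Metric.ball (0 : ℂ) 1).indicator f (Complex.polarCoord.symm p) := by
    refine (by fun_prop : Measurable fun p : ℝ × ℝ => ENNReal.ofReal p.1).mul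
      ((hf.indicator measurableSet_ball).comp ?_)
    rw [funext Complex.polarCoord_symm_apply]
    fun_prop
  rw [← lintegral_indicator measurableSet_ball, ← Complex.lintegral_comp_polarCoord_symm]
  simp only [smul_eq_mul, polarCoord_target]
  rw [Measure.volume_eq_prod, ← Measure.prod_restrict, lintegral_prod _ hm.aemeasurable,
    ← Set.Ioi_inter_Iio (a := 0) (b := 1), Set.inter_comm (Set.Ioi 0) (Set.Iio 1), ← Measure.restrict_restrict measurableSet_Iio,
    ← lintegral_indicator measurableSet_Iio]
  refine setLIntegral_congr_fun measurableSet_Ioi fun r (hr : 0 < r) => ?_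
  simp only [lintegral_const_mul' _ _ ENNReal.ofReal_ne_top]
  have hmem (θ : ℝ) : Complex.polarCoord.symm (r, θ) ∈ Metric.ball (0 : ℂ) 1 ↔ r < 1 := by
    rw [mem_ball_zero_iff, Complex.norm_polarCoord_symm, abs_of_pos hr]
  by_cases h : r < 1
  · simp only [Set.indicator, hmem, Set.mem_Iio, h, if_true]
    simp only [Complex.polarCoord_symm_apply]
  · simp only [Set.indicator, hmem, Set.mem_Iio, h, if_false, lintegral_zero, mul_zero]

/-- The pushforward under `Φ` of `dx ⊗ dν(y)`, where `dx` is the Haar probability measure on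
`ℝ/ℤ` and `dν(y) = 4π e^{−4πy} dy` on `(0,∞)`, is the normalized Lebesgue area measure
`(1/π)·dA` on the open unit disc. -/
theorem stmt_1 :
    Measure.map PhiM
        ((volume : Measure (AddCircle (1 : ℝ))).prod
          (((volume : Measure ℝ).restrict (Set.Ioi (0 : ℝ))).withDensity
            fun y => ENNReal.ofReal (4 * π * Real.exp (-(4 * π * y))))) =
      (ENNReal.ofReal π)⁻¹ • (volume : Measure ℂ).restrict (Metric.ball (0 : ℂ) 1) := by
  refine Measure.ext_of_lintegral _ fun f hf => ?_
  have hfP : Measurable fun p => f (PhiM p) := hf.comp measurable_PhiM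
  rw [lintegral_map hf measurable_PhiM, lintegral_prod_symm _ hfP.aemeasurable,
    lintegral_withDensity_eq_lintegral_mul _ (by fun_prop) hfP.lintegral_prod_left',
    lintegral_smul_measure, setLIntegral_ball_zero_one_polar hf,
    setLIntegral_Ioo_zero_one_eq_lintegral_exp_neg, smul_eq_mul,
    ← lintegral_const_mul' _ _ (by simp [Real.pi_pos])]
  refine lintegral_congr fun y => ?_
  rw [lintegral_polar_angle_eq_lintegral_toCircle
    fun z => f (((Real.exp (-(2 * π * y)) : ℝ) : ℂ) * z)]
  have hconst : ENNReal.ofReal (4 * π * Real.exp (-(4 * π * y))) =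
      (ENNReal.ofReal π)⁻¹ * (ENNReal.ofReal (2 * π * Real.exp (-(2 * π * y))) *
        (ENNReal.ofReal (Real.exp (-(2 * π * y))) * ENNReal.ofReal (2 * π))) := by
    rw [← ENNReal.ofReal_inv_of_pos Real.pi_pos, ← ENNReal.ofReal_mul (by positivity),
      ← ENNReal.ofReal_mul (by positivity), ← ENNReal.ofReal_mul (by positivity),
      show -(4 * π * y) = -(2 * π * y) + -(2 * π * y) by ring, Real.exp_add]
    congr 1
    field_simp
    ring
  have hPhi (x : AddCircle (1 : ℝ)) :
      PhiM (x, y) = ((Real.exp (-(2 * π * y)) : ℝ) : ℂ) * AddCircle.toCircle x := by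
    simp [PhiM, mul_comm]
  simp only [Pi.mul_apply, hconst, hPhi]
  ring
end

section
/- Let f be holomorphic on the punctured unit disc 𝔻 \ {0}. Then for every integer n and all radii 0 < r < s < 1, one has r^{−n} ∫₀¹ f(r e^{2πix}) e^{−2πinx} dx = s^{−n} ∫₀¹ f(s e^{2πix}) e^{−2πinx} dx; that is, the n-th Fourier coefficient f̂_n(r) = ∫₀¹ f(r e^{2πix}) e^{−2πinx} dx is proportional to rⁿ. -/
open Complex Real

/-- The rescaled Fourier coefficient `t⁻ⁿ f̂ₙ(t)` as a contour integral over the circle of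
radius `t`. -/
theorem zpow_neg_mul_fourierCoeff_eq_circleIntegral (f : ℂ → ℂ) (n : ℤ) {t : ℝ} (ht : t ≠ 0) :
    (t : ℂ) ^ (-n) * ∫ x in (0:ℝ)..1, f (t * Complex.exp (2 * π * Complex.I * x)) *
        Complex.exp (-(2 * π * Complex.I * n * x)) =
      (2 * π * Complex.I)⁻¹ * ∮ z in C(0, t), (z - 0)⁻¹ • (z ^ (-n) * f z) := by
  have htc : (t : ℂ) ≠ 0 := by exact_mod_cast ht
  have hπ : (π : ℂ) ≠ 0 := by exact_mod_cast Real.pi_ne_zero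
  have hscale := intervalIntegral.smul_integral_comp_mul_left (a := 0) (b := 1)
    (fun θ : ℝ => deriv (circleMap 0 t) θ •
      ((circleMap 0 t θ - 0)⁻¹ • (circleMap 0 t θ ^ (-n) * f (circleMap 0 t θ)))) (2 * π)
  rw [mul_zero, mul_one] at hscale
  rw [circleIntegral, ← hscale, Complex.real_smul, ← intervalIntegral.integral_const_mul,
    ← intervalIntegral.integral_const_mul, ← intervalIntegral.integral_const_mul]
  refine intervalIntegral.integral_congr fun x _ => ?_
  have harg : circleMap 0 t (2 * π * x) = t * Complex.exp (2 * π * Complex.I * x) := by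
    simp only [circleMap, zero_add]
    push_cast
    ring_nf
  have hpow : Complex.exp (2 * π * Complex.I * x) ^ (-n) =
      Complex.exp (-(2 * π * Complex.I * n * x)) := by
    rw [← Complex.exp_int_mul]
    push_cast
    ring_nf
  simp only [deriv_circleMap, harg, smul_eq_mul, sub_zero, mul_zpow, hpow]
  have hexp := Complex.exp_ne_zero (2 * π * Complex.I * x)
  push_cast
  field_simp

/-- For `f` holomorphic on the punctured unit disc, the `n`-th Fourier coefficient
`f̂_n(r) = ∫₀¹ f(r e^{2πix}) e^{−2πinx} dx` satisfies
`r^{−n} f̂_n(r) = s^{−n} f̂_n(s)` for `0 < r < s < 1`, i.e. it is proportional to `rⁿ`. -/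
theorem stmt_3 (f : ℂ → ℂ)
    (hf : DifferentiableOn ℂ f (Metric.ball (0 : ℂ) 1 \ {0}))
    (n : ℤ) (r s : ℝ) (hr : 0 < r) (hrs : r < s) (hs : s < 1) :
    (r : ℂ) ^ (-n) * ∫ x in (0:ℝ)..1, f (r * Complex.exp (2 * π * Complex.I * x)) *
        Complex.exp (-(2 * π * Complex.I * n * x)) =
      (s : ℂ) ^ (-n) * ∫ x in (0:ℝ)..1, f (s * Complex.exp (2 * π * Complex.I * x)) *
        Complex.exp (-(2 * π * Complex.I * n * x)) := by
  rw [zpow_neg_mul_fourierCoeff_eq_circleIntegral f n hr.ne',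
    zpow_neg_mul_fourierCoeff_eq_circleIntegral f n (hr.trans hrs).ne']
  have hopen : IsOpen (Metric.ball (0 : ℂ) 1 \ {0}) :=
    Metric.isOpen_ball.sdiff isClosed_singleton
  have hd : ∀ z ∈ Metric.closedBall (0 : ℂ) s \ Metric.ball 0 r,
      DifferentiableAt ℂ (fun z => z ^ (-n) * f z) z := by
    rintro z ⟨hzs, hzr⟩
    rw [mem_closedBall_zero_iff] at hzs
    rw [mem_ball_zero_iff, not_lt] at hzr
    have hz : z ≠ 0 := norm_pos_iff.mp (hr.trans_le hzr)
    have hmem : z ∈ Metric.ball (0 : ℂ) 1 \ {0} :=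
      ⟨mem_ball_zero_iff.mpr (hzs.trans_lt hs), hz⟩
    exact (differentiableAt_zpow.mpr (Or.inl hz)).mul (hf.differentiableAt (hopen.mem_nhds hmem))
  rw [Complex.circleIntegral_sub_center_inv_smul_eq_of_differentiable_on_annulus_off_countable
    hr hrs.le Set.countable_empty
    (fun z hz => (hd z hz).continuousAt.continuousWithinAt)
    (fun z hz => hd z ⟨Metric.ball_subset_closedBall hz.1.1,
      fun h => hz.1.2 (Metric.ball_subset_closedBall h)⟩)]
end

section
/- Let f be holomorphic on the punctured unit disc 𝔻 \ {0}, and suppose that for every integer n < 0 the function r ↦ ∫₀¹ f(r e^{2πix}) e^{−2πinx} dx is Lebesgue integrable on (0,1). Then f extends to a holomorphic function on the full disc 𝔻. -/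
open Complex Real MeasureTheory

/-- The moments of `f` on the circle of radius `r` are its Fourier coefficients of negative index,
up to normalization. -/
theorem circleIntegral_mul_pow_eq_fourierCoefficient (f : ℂ → ℂ) (r : ℝ) (k : ℕ) :
    (∮ z in C(0, r), f z * z ^ k) = 2 * π * Complex.I * (r : ℂ) ^ (k + 1) *
      ∫ x in (0:ℝ)..1, f (r * Complex.exp (2 * π * Complex.I * x)) *
        Complex.exp (-(2 * π * Complex.I * (-(k + 1 : ℤ) : ℤ) * x)) := by
  have h := intervalIntegral.smul_integral_comp_mul_left (a := 0) (b := 1)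
    (fun θ : ℝ => deriv (circleMap 0 r) θ • (f (circleMap 0 r θ) * circleMap 0 r θ ^ k)) (2 * π)
  rw [mul_zero, mul_one] at h
  rw [circleIntegral, ← h, ← intervalIntegral.integral_smul,
    ← intervalIntegral.integral_const_mul]
  refine intervalIntegral.integral_congr fun x _ => ?_
  have hexp : Complex.exp (-(2 * π * Complex.I * (-(k + 1 : ℤ) : ℤ) * x)) =
      Complex.exp (2 * π * Complex.I * x) ^ (k + 1) := by
    rw [← Complex.exp_nat_mul]
    congr 1
    push_cast
    ring
  have hmap : circleMap 0 r (2 * π * x) = r * Complex.exp (2 * π * Complex.I * x) := by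
    rw [circleMap_zero]
    congr 2
    push_cast
    ring
  simp only [deriv_circleMap, hexp, hmap, smul_eq_mul, Complex.real_smul]
  push_cast
  ring

/-- If all nonnegative moments of `f` vanish on a circle, so does its Cauchy transform outside. -/
theorem circleIntegral_sub_inv_mul_eq_zero_of_moments {f : ℂ → ℂ} {r : ℝ} {w : ℂ} (hr : 0 ≤ r)
    (hw : r < ‖w‖) (hf : ContinuousOn f (Metric.sphere 0 r))
    (hmom : ∀ k : ℕ, (∮ z in C(0, r), f z * z ^ k) = 0) :
    (∮ z in C(0, r), (z - w)⁻¹ * f z) = 0 := by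
  have hne : ∀ z ∈ Metric.sphere (0 : ℂ) r, z - w ≠ 0 := by
    rintro z hz h
    rw [sub_eq_zero.1 h, mem_sphere_zero_iff_norm] at hz
    exact hw.ne' hz
  have hcont : ContinuousOn (fun z => (z - w)⁻¹ * f z) (Metric.sphere 0 r) :=
    ((continuousOn_id.sub continuousOn_const).inv₀ hne).mul hf
  have hpow : ∀ N : ℕ, (∮ z in C(0, r), (z - w)⁻¹ * f z * z ^ N) =
      w ^ N * ∮ z in C(0, r), (z - w)⁻¹ * f z := by
    intro N
    induction N with
    | zero => simp
    | succ N ih =>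
      have hsplit : (∮ z in C(0, r), (z - w)⁻¹ * f z * z ^ (N + 1)) =
          ∮ z in C(0, r), (f z * z ^ N + w • ((z - w)⁻¹ * f z * z ^ N)) := by
        refine circleIntegral.integral_congr hr fun z hz => ?_
        have := hne z hz
        simp only [smul_eq_mul]
        field_simp
        ring
      rw [hsplit, circleIntegral.integral_add, circleIntegral.integral_smul, hmom, ih, smul_eq_mul]
      · ring
      · exact (hf.mul (by fun_prop)).circleIntegrable hr
      · exact ((hcont.mul (by fun_prop)).const_smul w).circleIntegrable hr
  obtain ⟨M, hM⟩ := (isCompact_sphere (0 : ℂ) r).exists_bound_of_continuousOn hcont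
  have hw0 : 0 < ‖w‖ := hr.trans_lt hw
  have hbound : ∀ N : ℕ, ‖∮ z in C(0, r), (z - w)⁻¹ * f z‖ ≤ 2 * π * r * M * (r / ‖w‖) ^ N := by
    intro N
    have h := circleIntegral.norm_integral_le_of_norm_le_const hr
      (f := fun z => (z - w)⁻¹ * f z * z ^ N) (C := M * r ^ N) fun z hz => by
        rw [norm_mul, norm_pow, mem_sphere_zero_iff_norm.1 hz]
        exact mul_le_mul_of_nonneg_right (hM z hz) (by positivity)
    rw [hpow, norm_mul, norm_pow] at h
    rw [div_pow, ← mul_div_assoc, le_div_iff₀ (by positivity)]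
    linarith
  have hlim : Filter.Tendsto (fun N : ℕ => 2 * π * r * M * (r / ‖w‖) ^ N) Filter.atTop (nhds 0) := by
    simpa using (tendsto_pow_atTop_nhds_zero_of_lt_one (by positivity)
      ((div_lt_one hw0).2 hw)).const_mul (2 * π * r * M)
  exact norm_le_zero_iff.1 (ge_of_tendsto' hlim hbound)

/-- Cauchy's integral formula in an annulus, assuming that the nonnegative moments of `f` on the
inner circle vanish. -/
theorem circleIntegral_sub_inv_mul_of_annulus {f : ℂ → ℂ} {r R : ℝ} {w : ℂ} {U : Set ℂ}
    (hU : IsOpen U) (hf : DifferentiableOn ℂ f U)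
    (hsub : Metric.closedBall 0 R \ Metric.ball 0 r ⊆ U) (hr : 0 < r) (hrw : r < ‖w‖)
    (hwR : ‖w‖ < R) (hmom : ∀ k : ℕ, (∮ z in C(0, r), f z * z ^ k) = 0) :
    (∮ z in C(0, R), (z - w)⁻¹ * f z) = 2 * π * Complex.I * f w := by
  have hR : 0 < R := by linarith
  have hwU : U ∈ nhds w := hU.mem_nhds (hsub (by simp [hwR.le, hrw.le]))
  have hcircle : ∀ ρ, 0 < ρ → r ≤ ρ → ρ ≤ R → ρ ≠ ‖w‖ →
      (∮ z in C(0, ρ), dslope f w z) =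
        (∮ z in C(0, ρ), (z - w)⁻¹ * f z) - f w * ∮ z in C(0, ρ), (z - w)⁻¹ := by
    intro ρ hρ hrρ hρR hρw
    have hne : ∀ z ∈ Metric.sphere (0 : ℂ) ρ, z - w ≠ 0 := by
      rintro z hz h
      rw [sub_eq_zero.1 h, mem_sphere_zero_iff_norm] at hz
      exact hρw hz.symm
    have hsphere : Metric.sphere (0 : ℂ) ρ ⊆ U := by
      intro z hz
      rw [mem_sphere_zero_iff_norm] at hz
      exact hsub (by simp [hz, hρR, hrρ])
    have hinv : ContinuousOn (fun z => (z - w)⁻¹) (Metric.sphere 0 ρ) :=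
      (continuousOn_id.sub continuousOn_const).inv₀ hne
    have hinv_mul : ContinuousOn (fun z => (z - w)⁻¹ * f z) (Metric.sphere 0 ρ) :=
      hinv.mul (hf.continuousOn.mono hsphere)
    have hinv_smul : ContinuousOn (fun z => f w • (z - w)⁻¹) (Metric.sphere 0 ρ) :=
      hinv.const_smul (f w)
    rw [← smul_eq_mul (f w), ← circleIntegral.integral_smul, ← circleIntegral.integral_sub
      (hinv_mul.circleIntegrable hρ.le) (hinv_smul.circleIntegrable hρ.le)]
    refine circleIntegral.integral_congr hρ.le fun z hz => ?_
    simp only [dslope_of_ne f (sub_ne_zero.1 (hne z hz)), slope_def_module, smul_eq_mul]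
    ring
  have hannulus := Complex.circleIntegral_eq_of_differentiable_on_annulus_off_countable hr
    (hrw.trans hwR).le (Set.countable_singleton w) (f := dslope f w)
    (((continuousOn_dslope hwU).2 ⟨hf.continuousOn, hf.differentiableAt hwU⟩).mono hsub)
    fun z hz => (differentiableAt_dslope_of_ne hz.2).2 <| hf.differentiableAt <| hU.mem_nhds <|
      hsub ⟨Metric.ball_subset_closedBall hz.1.1, fun h => hz.1.2 (Metric.ball_subset_closedBall h)⟩
  have hinner : (∮ z in C(0, r), (z - w)⁻¹) = 0 := by
    have hd : ∀ z ∈ Metric.closedBall (0 : ℂ) r,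
        DifferentiableAt ℂ (fun z => (z - w)⁻¹) z := by
      intro z hz
      refine (differentiableAt_id.sub_const w).inv fun h => ?_
      rw [mem_closedBall_zero_iff, show z = w from sub_eq_zero.1 h] at hz
      exact hrw.not_ge hz
    exact Complex.circleIntegral_eq_zero_of_differentiable_on_off_countable hr.le
      Set.countable_empty (fun z hz => (hd z hz).continuousAt.continuousWithinAt)
      fun z hz => hd z (Metric.ball_subset_closedBall hz.1)
  have hf_inner : ContinuousOn f (Metric.sphere 0 r) := hf.continuousOn.mono fun z hz =>
    hsub (by rw [mem_sphere_zero_iff_norm] at hz; simp [hz, (hrw.trans hwR).le])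
  rw [hcircle R hR (hrw.trans hwR).le le_rfl hwR.ne',
    hcircle r hr le_rfl (hrw.trans hwR).le hrw.ne, hinner,
    circleIntegral_sub_inv_mul_eq_zero_of_moments hr.le hrw hf_inner hmom,
    circleIntegral.integral_sub_inv_of_mem_ball (by simpa using hwR)] at hannulus
  linear_combination hannulus

/-- If the Fourier coefficient of index `-(k + 1)` of `f` is integrable in the radius, then the
`k`-th moment of `f` vanishes on each circle. -/
theorem circleIntegral_mul_pow_eq_zero_of_integrableOn {f : ℂ → ℂ}
    (hf : DifferentiableOn ℂ f (Metric.ball (0 : ℂ) 1 \ {0})) (k : ℕ)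
    (hint : IntegrableOn (fun r : ℝ => ∫ x in (0:ℝ)..1,
      f (r * Complex.exp (2 * π * Complex.I * x)) *
        Complex.exp (-(2 * π * Complex.I * (-(k + 1 : ℤ) : ℤ) * x))) (Set.Ioo (0 : ℝ) 1))
    {r : ℝ} (hr : r ∈ Set.Ioo (0 : ℝ) 1) : (∮ z in C(0, r), f z * z ^ k) = 0 := by
  have hd : DifferentiableOn ℂ (fun z => f z * z ^ k) (Metric.ball (0 : ℂ) 1 \ {0}) :=
    hf.mul (by fun_prop)
  have hopen : IsOpen (Metric.ball (0 : ℂ) 1 \ {0}) := Metric.isOpen_ball.sdiff isClosed_singleton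
  have hconst_le : ∀ s t : ℝ, 0 < s → s ≤ t → t < 1 →
      (∮ z in C(0, t), f z * z ^ k) = ∮ z in C(0, s), f z * z ^ k := by
    intro s t hs hst ht
    have hsub : Metric.closedBall (0 : ℂ) t \ Metric.ball 0 s ⊆ Metric.ball (0 : ℂ) 1 \ {0} := by
      rintro z ⟨hz, hz'⟩
      rw [mem_closedBall_zero_iff] at hz
      refine ⟨mem_ball_zero_iff.2 (hz.trans_lt ht), ?_⟩
      rintro rfl
      exact hz' (Metric.mem_ball_self hs)
    exact Complex.circleIntegral_eq_of_differentiable_on_annulus_off_countable hs hst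
      Set.countable_empty (hd.continuousOn.mono hsub) fun z hz => hd.differentiableAt <|
        hopen.mem_nhds <| hsub ⟨Metric.ball_subset_closedBall hz.1.1,
          fun h => hz.1.2 (Metric.ball_subset_closedBall h)⟩
  have hconst : ∀ s ∈ Set.Ioo (0 : ℝ) 1,
      (∮ z in C(0, s), f z * z ^ k) = ∮ z in C(0, r), f z * z ^ k := by
    intro s hs
    rcases le_total s r with h | h
    · exact (hconst_le s r hs.1 h hr.2).symm
    · exact hconst_le r s hr.1 h hs.2
  by_contra hne
  have hpow : IntegrableOn (fun s : ℝ => (s : ℂ) ^ (-(k + 1 : ℂ))) (Set.Ioo 0 1) := by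
    refine IntegrableOn.congr_fun
      (hint.const_mul (2 * π * Complex.I / ∮ z in C(0, r), f z * z ^ k)) (fun s hs => ?_)
      measurableSet_Ioo
    have h := (circleIntegral_mul_pow_eq_fourierCoefficient f s k).symm.trans (hconst s hs)
    have hs0 : (s : ℂ) ≠ 0 := by exact_mod_cast hs.1.ne'
    have hcpow : (s : ℂ) ^ (-(k + 1 : ℂ)) = ((s : ℂ) ^ (k + 1))⁻¹ := by
      rw [Complex.cpow_neg]
      norm_cast
    simp only [hcpow]
    rw [div_mul_eq_mul_div, div_eq_iff hne, ← h, mul_right_comm _ ((s : ℂ) ^ (k + 1)),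
      mul_comm _ ((s : ℂ) ^ (k + 1)), inv_mul_cancel_left₀ (pow_ne_zero _ hs0)]
  rw [intervalIntegral.integrableOn_Ioo_cpow_iff one_pos] at hpow
  simp at hpow
  have : (0 : ℝ) ≤ k := k.cast_nonneg
  linarith

/-- If `f` is holomorphic on the punctured unit disc and for every `n < 0` the function
`r ↦ f̂_n(r) = ∫₀¹ f(r e^{2πix}) e^{−2πinx} dx` is Lebesgue integrable on `(0,1)`, then `f`
extends to a holomorphic function on the full disc. -/
theorem stmt_4 (f : ℂ → ℂ)
    (hf : DifferentiableOn ℂ f (Metric.ball (0 : ℂ) 1 \ {0}))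
    (hint : ∀ n : ℤ, n < 0 →
      IntegrableOn (fun r : ℝ => ∫ x in (0:ℝ)..1,
        f (r * Complex.exp (2 * π * Complex.I * x)) *
          Complex.exp (-(2 * π * Complex.I * n * x))) (Set.Ioo (0 : ℝ) 1)) :
    ∃ g : ℂ → ℂ, DifferentiableOn ℂ g (Metric.ball (0 : ℂ) 1) ∧
      Set.EqOn g f (Metric.ball (0 : ℂ) 1 \ {0}) := by
  have hopen : IsOpen (Metric.ball (0 : ℂ) 1 \ {0}) := Metric.isOpen_ball.sdiff isClosed_singleton
  have hmom : ∀ r ∈ Set.Ioo (0 : ℝ) 1, ∀ k : ℕ, (∮ z in C(0, r), f z * z ^ k) = 0 := fun r hr k =>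
    circleIntegral_mul_pow_eq_zero_of_integrableOn hf k (hint (-(k + 1 : ℤ)) (by omega)) hr
  have hcont : ContinuousOn f (Metric.sphere 0 (1 / 2)) := hf.continuousOn.mono fun z hz => by
    rw [mem_sphere_zero_iff_norm] at hz
    refine ⟨by rw [mem_ball_zero_iff, hz]; norm_num, ?_⟩
    rintro rfl
    norm_num at hz
  obtain ⟨M, hM⟩ := (isCompact_sphere (0 : ℂ) (1 / 2)).exists_bound_of_continuousOn hcont
  have hbound : ∀ w ∈ Metric.ball (0 : ℂ) (1 / 4) \ {0},
      ‖2 * π * Complex.I * f w‖ ≤ 2 * π * (1 / 2) * (4 * M) := by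
    rintro w ⟨hw, hw0⟩
    rw [mem_ball_zero_iff] at hw
    have hwpos : 0 < ‖w‖ := norm_pos_iff.2 hw0
    have hsub : Metric.closedBall (0 : ℂ) (1 / 2) \ Metric.ball 0 (‖w‖ / 2) ⊆
        Metric.ball (0 : ℂ) 1 \ {0} := by
      rintro z ⟨hz, hz'⟩
      rw [mem_closedBall_zero_iff] at hz
      refine ⟨mem_ball_zero_iff.2 (by linarith), ?_⟩
      rintro rfl
      exact hz' (Metric.mem_ball_self (by positivity))
    rw [← circleIntegral_sub_inv_mul_of_annulus hopen hf hsub (by positivity) (by linarith)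
      (by linarith) (hmom (‖w‖ / 2) ⟨by positivity, by linarith⟩)]
    refine circleIntegral.norm_integral_le_of_norm_le_const (by norm_num) fun z hz => ?_
    have hfz := hM z hz
    rw [mem_sphere_zero_iff_norm] at hz
    have hdist : (1 / 4 : ℝ) ≤ ‖z - w‖ := by linarith [norm_sub_norm_le z w]
    rw [norm_mul, norm_inv]
    refine mul_le_mul ?_ hfz (norm_nonneg _) (by norm_num)
    exact inv_le_of_inv_le₀ (by norm_num) (by linarith)
  have hbdd : Filter.IsBoundedUnder (· ≤ ·) (nhdsWithin 0 {0}ᶜ) fun z => ‖f z - f 0‖ := by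
    refine ⟨4 * M / 2 + ‖f 0‖, Filter.eventually_map.2 <|
      mem_nhdsWithin_iff_exists_mem_nhds_inter.2
        ⟨Metric.ball 0 (1 / 4), Metric.ball_mem_nhds _ (by norm_num), fun z hz => ?_⟩⟩
    refine norm_sub_le_of_le ?_ le_rfl
    have h := hbound z hz
    have hnorm : ‖2 * π * Complex.I * f z‖ = 2 * π * ‖f z‖ := by
      simp [abs_of_pos Real.pi_pos]
    rw [hnorm, mul_assoc (2 * π)] at h
    linarith [le_of_mul_le_mul_left h (by positivity)]
  exact ⟨_, Complex.differentiableOn_update_limUnder_of_isLittleO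
    (Metric.ball_mem_nhds _ one_pos) hf hbdd.isLittleO_sub_self_inv,
    fun z hz => Function.update_of_ne hz.2 _ _⟩
end
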